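/- arXiv:1101.5367 — 2 statements merged into one kernel-verified Lean document; each statement's English description precedes it below -/
import Mathlib

section
/- Let V act on the finite group G as in the context with C_G(V) = 1, and suppose moreover that G is nilpotent. Let {i, j, k} = {1, 2, 3}. Then G′ ∩ G_k equals the subgroup of G generated by the set {s ∈ G_k : there exist a ∈ G_i, b ∈ G_j and t ∈ G_j with b^a = s·t·s}, where G′ is the derived subgroup of G. -/
/-- The subgroup of fixed points of an automorphism of a group. -/
def fixedSubgroup {G : Type} [Group G] (σ : MulAut G) : Subgroup G where
  carrier := {x | σ x = x}
  one_mem' := map_one σ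
  mul_mem' := fun {a b} ha hb => by
    simp only [Set.mem_setOf_eq] at *
    rw [map_mul, ha, hb]
  inv_mem' := fun {a} ha => by
    simp only [Set.mem_setOf_eq] at *
    rw [map_inv, ha]

/-- Three automorphisms acting like the involutions of a four-group, on a group with square roots. -/
structure KFAct {G : Type} [Group G] (m : ℕ) (σ τ ρ : MulAut G) : Prop where
  rt : ∀ x : G, x ^ m * x ^ m = x
  ss : ∀ x, σ (σ x) = x
  tt : ∀ x, τ (τ x) = x
  rr : ∀ x, ρ (ρ x) = x
  st : ∀ x, σ (τ x) = ρ x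
  ts : ∀ x, τ (σ x) = ρ x
  sr : ∀ x, σ (ρ x) = τ x
  rs : ∀ x, ρ (σ x) = τ x
  tr : ∀ x, τ (ρ x) = σ x
  rt' : ∀ x, ρ (τ x) = σ x
  fx : ∀ x, σ x = x → τ x = x → x = 1

namespace KFAct

open scoped commutatorElement

variable {G : Type} [Group G] {m : ℕ} {σ τ ρ : MulAut G}

theorem swap (h : KFAct m σ τ ρ) : KFAct m τ σ ρ :=
  ⟨h.rt, h.tt, h.ss, h.rr, h.ts, h.st, h.tr, h.rt', h.sr, h.rs, fun x a b => h.fx x b a⟩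

theorem rot (h : KFAct m σ τ ρ) : KFAct m τ ρ σ :=
  ⟨h.rt, h.tt, h.rr, h.ss, h.tr, h.rt', h.ts, h.st, h.rs, h.sr, fun x a b => by
    refine h.fx x ?_ a
    rw [← h.tr, b, a]⟩

theorem sq_inj {Q : Type} [Group Q] {m : ℕ} (h : ∀ x : Q, x ^ m * x ^ m = x) {x y : Q}
    (hxy : x * x = y * y) : x = y := by
  rw [← h x, ← h y, ← (Commute.refl x).mul_pow, hxy, (Commute.refl y).mul_pow]

/-- Splitting of an element into a part fixed and a part inverted by `τ`. -/
theorem split (h : KFAct m σ τ ρ) (x : G) :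
    τ (x * (((τ x)⁻¹ * x) ^ m)⁻¹) = x * (((τ x)⁻¹ * x) ^ m)⁻¹ ∧
    τ (((τ x)⁻¹ * x) ^ m) = (((τ x)⁻¹ * x) ^ m)⁻¹ := by
  have h2 : τ (((τ x)⁻¹ * x) ^ m) = (((τ x)⁻¹ * x) ^ m)⁻¹ := by
    rw [map_pow, map_mul, map_inv, h.tt, ← inv_pow]
    simp
  refine ⟨?_, h2⟩
  rw [map_mul, map_inv, h2, inv_inv, eq_mul_inv_iff_mul_eq, mul_assoc, h.rt]
  simp

theorem inv_of_fix (h : KFAct m σ τ ρ) {x : G} (hx : σ x = x) : τ x = x⁻¹ := by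
  obtain ⟨h1, h2⟩ := h.split x
  have hs : σ (τ x) = τ x := by rw [h.st, ← h.ts, hx]
  have h3 := h.fx _ (by rw [map_mul, map_inv, map_pow, map_mul, map_inv, hs, hx]) h1
  rw [mul_inv_eq_one] at h3
  rw [← h3] at h2
  exact h2

/-- An element inverted by `σ` decomposes as `s * t * s`. -/
theorem sts (h : KFAct m σ τ ρ) {x : G} (hx : σ x = x⁻¹) (M : Subgroup G) (hxM : x ∈ M)
    (hM : ∀ y ∈ M, ρ y ∈ M) :
    ∃ s ∈ M, ∃ t ∈ M, ρ s = s ∧ τ t = t ∧ x = s * t * s := by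
  set z := (x * (ρ x)⁻¹) ^ m with hz
  have hzz : z * z = x * (ρ x)⁻¹ := h.rt _
  have hzM : z ∈ M := M.pow_mem (M.mul_mem hxM (M.inv_mem (hM _ hxM))) _
  have hrz : ρ z = z⁻¹ := by
    rw [hz, map_pow, map_mul, map_inv, h.rr, ← inv_pow]
    simp
  set s := (z⁻¹ * x) ^ m with hs
  have hss : s * s = z⁻¹ * x := h.rt _
  have hsM : s ∈ M := M.pow_mem (M.mul_mem (M.inv_mem hzM) hxM) _
  have hrs : ρ s = s := by
    rw [hs, map_pow, map_mul, map_inv, hrz, inv_inv]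
    congr 1
    rw [eq_inv_mul_iff_mul_eq, ← mul_assoc, hzz]
    simp
  have hx2 : x = s * (s⁻¹ * z * s) * s := by
    have : x = z * (s * s) := by rw [hss]; simp
    rw [this]; group
  have hsi : σ s = s⁻¹ := h.rot.rot.inv_of_fix hrs
  refine ⟨s, hsM, s⁻¹ * z * s, M.mul_mem (M.mul_mem (M.inv_mem hsM) hzM) hsM, hrs, ?_, hx2⟩
  set t := s⁻¹ * z * s with ht
  have h1 : ρ t = t⁻¹ := by
    rw [ht, map_mul, map_mul, map_inv, hrs, hrz]; group
  have h2 : σ t = t⁻¹ := by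
    have h3 := hx
    rw [hx2, map_mul, map_mul, hsi, mul_inv_rev, mul_inv_rev, ← mul_assoc] at h3
    exact mul_left_cancel (mul_right_cancel h3)
  rw [← h.sr, h1, map_inv, h2, inv_inv]

theorem gen (h : KFAct m σ τ ρ) (M : Subgroup G) (hMt : ∀ y ∈ M, τ y ∈ M)
    (hMr : ∀ y ∈ M, ρ y ∈ M) (P : G → Prop)
    (hmul : ∀ x ∈ M, ∀ y ∈ M, P x → P y → P (x * y))
    (h1 : ∀ x ∈ M, σ x = x → P x) (h2 : ∀ x ∈ M, τ x = x → P x) (h3 : ∀ x ∈ M, ρ x = x → P x)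
    (x : G) (hx : x ∈ M) : P x := by
  obtain ⟨a1, a2⟩ := h.split x
  set q := ((τ x)⁻¹ * x) ^ m with hq
  have hqM : q ∈ M := M.pow_mem (M.mul_mem (M.inv_mem (hMt _ hx)) hx) _
  obtain ⟨s, hs, t, ht, hs1, ht1, e⟩ := h.swap.sts a2 M hqM hMr
  have hpM := M.mul_mem hx (M.inv_mem hqM)
  have : x = (x * q⁻¹) * (s * t * s) := by rw [← e]; simp
  rw [this]
  have hst := M.mul_mem hs ht
  exact hmul _ hpM _ (M.mul_mem hst hs) (h2 _ hpM a1)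
    (hmul _ hst _ hs (hmul _ hs _ ht (h3 _ hs hs1) (h1 _ ht ht1)) (h3 _ hs hs1))

theorem comm_of_fix (h : KFAct m σ τ ρ) {x y : G} (hx : σ x = x) (hy : σ y = y) :
    x * y = y * x := by
  have h1 := h.inv_of_fix (x := x * y) (by rw [map_mul, hx, hy])
  rw [map_mul, h.inv_of_fix hx, h.inv_of_fix hy, ← mul_inv_rev] at h1
  exact (inv_injective h1).symm

theorem comm_inv_inv {Q : Type} [Group Q] (x y : Q) (hc : ∀ z, ⁅x, y⁆ * z = z * ⁅x, y⁆) :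
    ⁅x⁻¹, y⁻¹⁆ = ⁅x, y⁆ := by
  have h1 := hc (y * x)
  have : ⁅x⁻¹, y⁻¹⁆ = (y * x)⁻¹ * (⁅x, y⁆ * (y * x)) := by
    simp only [commutatorElement_def]; group
  rw [this, h1]; group

theorem comm_inv_left {Q : Type} [Group Q] (x y : Q) (hc : ∀ z, ⁅x, y⁆ * z = z * ⁅x, y⁆) :
    ⁅x⁻¹, y⁆ = ⁅x, y⁆⁻¹ := by
  have : ⁅x⁻¹, y⁆ = x⁻¹ * ⁅x, y⁆⁻¹ * x := by
    simp only [commutatorElement_def]; group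
  rw [this, mul_assoc, inv_mul_eq_iff_eq_mul, inv_mul_eq_iff_eq_mul, ← mul_assoc, hc]; group

theorem comm_inv_right {Q : Type} [Group Q] (x y : Q) (hc : ∀ z, ⁅x, y⁆ * z = z * ⁅x, y⁆) :
    ⁅x, y⁻¹⁆ = ⁅x, y⁆⁻¹ := by
  have : ⁅x, y⁻¹⁆ = y⁻¹ * ⁅x, y⁆⁻¹ * y := by
    simp only [commutatorElement_def]; group
  rw [this, mul_assoc, inv_mul_eq_iff_eq_mul, inv_mul_eq_iff_eq_mul, ← mul_assoc, hc]; group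

/-- Core computation with a star modulo a subgroup making the commutator central. -/
theorem star_sq {Q : Type} [Group Q] (hQ : ∀ x : Q, x ^ m * x ^ m = x) {b c s t : Q}
    (e1 : b * c = s * t * s) (e2 : b⁻¹ * c = s * t⁻¹ * s) :
    c = s * s := by
  have h1 : b * b = (s * t * s⁻¹) * (s * t * s⁻¹) := by
    have h2 : b * c * (b⁻¹ * c)⁻¹ = b * b := by
      rw [mul_inv_rev, inv_inv, ← mul_assoc]; group
    rw [← h2, e1, e2]; group
  have h3 := sq_inj hQ h1
  rw [h3] at e1
  have : s * t * s⁻¹ * c = s * t * s⁻¹ * (s * s) := by rw [e1]; group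
  exact mul_left_cancel this

theorem step (h : KFAct m σ τ ρ) (K M N : Subgroup G) [hKc : K.Characteristic]
    [hNc : N.Characteristic] (hM : M = ⁅K, ⊤⁆) (hN : N = ⁅M, ⊤⁆)
    (H : Subgroup G) (hHr : ∀ x ∈ H, ρ x = x)
    (hstar : ∀ a b t s : G, σ a = a → τ b = b → τ t = t → ρ s = s →
      a⁻¹ * b * a = s * t * s → s ∈ H)
    (g : G) (hg : g ∈ M) (hgr : ρ g = g) : ∃ x ∈ H, x⁻¹ * g ∈ N := by
  have hinvK : ∀ (f : MulAut G), ∀ y ∈ K, f y ∈ K := fun f y hy =>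
    (Subgroup.characteristic_iff_le_comap.mp hKc f) hy
  have hinvN : ∀ (f : MulAut G), ∀ y ∈ N, f y ∈ N := fun f y hy =>
    (Subgroup.characteristic_iff_le_comap.mp hNc f) hy
  let π : G →* G ⧸ N := QuotientGroup.mk' N
  have hQ : ∀ x : G ⧸ N, x ^ m * x ^ m = x := by
    intro x
    obtain ⟨y, rfl⟩ := QuotientGroup.mk'_surjective N x
    rw [← map_pow, ← map_mul, h.rt]
  have hπ : ∀ x y : G, π x = π y ↔ x⁻¹ * y ∈ N := fun x y => QuotientGroup.eq
  have hπr : ∀ x y : G, π x = π y → π (ρ x) = π (ρ y) := by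
    intro x y hxy
    rw [hπ] at hxy ⊢
    have := hinvN ρ _ hxy
    rwa [map_mul, map_inv] at this
  have hcen : ∀ c ∈ M, ∀ z : G ⧸ N, π c * z = z * π c := by
    intro c hc z
    obtain ⟨y, rfl⟩ := QuotientGroup.mk'_surjective N z
    have : ⁅c, y⁆ ∈ N := by
      rw [hN]; exact Subgroup.commutator_mem_commutator hc (Subgroup.mem_top _)
    have h1 : π ⁅c, y⁆ = 1 := (QuotientGroup.eq_one_iff _).mpr this
    rw [map_commutatorElement, commutatorElement_eq_one_iff_mul_comm] at h1
    exact h1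
  have hcM : ∀ x ∈ K, ∀ y, ⁅x, y⁆ ∈ M := by
    intro x hx y
    rw [hM]; exact Subgroup.commutator_mem_commutator hx (Subgroup.mem_top _)
  have hcc : ∀ x ∈ K, ∀ y, ∀ z, ⁅π x, π y⁆ * z = z * ⁅π x, π y⁆ := by
    intro x hx y z
    rw [← map_commutatorElement]
    exact hcen _ (hcM x hx y) z
  let P : G → Prop := fun g => ∃ x ∈ H, π (ρ g) * π g = π x * π x
  have hP1 : ∀ u, π (ρ u) = (π u)⁻¹ → P u := fun u hu =>
    ⟨1, H.one_mem, by rw [hu]; simp⟩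
  have hPm : ∀ u ∈ M, ∀ v ∈ M, P u → P v → ∀ w, π w = π u * π v → P w := by
    rintro u hu v hv ⟨x, hx, ex⟩ ⟨y, hy, ey⟩ w hw
    refine ⟨x * y, H.mul_mem hx hy, ?_⟩
    have hxy : π x * π y = π y * π x := by
      rw [← map_mul, h.rot.rot.comm_of_fix (hHr x hx) (hHr y hy), map_mul]
    have e : π (ρ w) = π (ρ u) * π (ρ v) := by
      rw [← map_mul, ← map_mul]; exact hπr _ _ (by rw [hw, map_mul])
    calc π (ρ w) * π w = π (ρ u) * (π (ρ v) * π u) * π v := by rw [e, hw]; group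
      _ = π (ρ u) * (π u * π (ρ v)) * π v := by rw [hcen u hu]
      _ = (π (ρ u) * π u) * (π (ρ v) * π v) := by group
      _ = π x * (π x * π y) * π y := by rw [ex, ey]; group
      _ = π x * (π y * π x) * π y := by rw [hxy]
      _ = π (x * y) * π (x * y) := by rw [map_mul]; group
  have hPinv : ∀ u ∈ M, P u → P u⁻¹ := by
    rintro u hu ⟨x, hx, ex⟩
    refine ⟨x⁻¹, H.inv_mem hx, ?_⟩
    rw [map_inv, map_inv, map_inv, map_inv, ← mul_inv_rev, ← mul_inv_rev, hcen u hu, ex]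
  have hPs : ∀ u s, s ∈ H → π (ρ u) = π u → π u = π s * π s → P u := by
    intro u s hs h1 h2
    exact ⟨s * s, H.mul_mem hs hs, by rw [h1, map_mul, ← h2]⟩
  have hst : ∀ a b, σ a = a → τ b = b → ⁅b, a⁆ ∈ M → ⁅b⁻¹, a⁻¹⁆ ∈ M →
      ∃ s ∈ H, π ⁅b, a⁆ = π s * π s := by
    intro a b ha hb h1 h2
    have hsb : σ b = b⁻¹ := h.swap.inv_of_fix hb
    have hrb : ρ b = b⁻¹ := h.rot.inv_of_fix hb
    have hra : ρ a = a⁻¹ := h.rot.rot.swap.inv_of_fix ha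
    obtain ⟨s, -, t, -, hs, ht, e⟩ := h.sts (x := a⁻¹ * b * a)
      (by rw [map_mul, map_mul, map_inv, ha, hsb]; group) ⊤ (Subgroup.mem_top _)
      (fun _ _ => Subgroup.mem_top _)
    have hrt : ρ t = t⁻¹ := h.rot.inv_of_fix ht
    refine ⟨s, hstar a b t s ha hb ht hs e, ?_⟩
    have hcc' : ∀ z, ⁅π b, π a⁆ * z = z * ⁅π b, π a⁆ := by
      intro z
      rw [← map_commutatorElement]; exact hcen _ h1 z
    have hii : ⁅(π b)⁻¹, (π a)⁻¹⁆ = ⁅π b, π a⁆ := comm_inv_inv _ _ hcc'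
    rw [map_commutatorElement]
    refine star_sq hQ (b := π b) (t := π t) ?_ ?_
    · rw [← hii, ← map_mul, ← map_mul, ← e]
      simp only [commutatorElement_def, map_mul, map_inv]; group
    · have e' := congrArg ρ e
      simp only [map_mul, map_inv, hra, hrb, hs, hrt] at e'
      rw [← map_inv π t, ← map_mul, ← map_mul, ← e']
      simp only [commutatorElement_def, map_mul, map_inv]; group
  have is_t : ∀ {x}, σ x = x → ρ x = x⁻¹ := fun hx => h.rot.rot.swap.inv_of_fix hx
  have it_r : ∀ {x}, τ x = x → ρ x = x⁻¹ := fun hx => h.rot.inv_of_fix hx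
  have hone : ∀ u, u = 1 → P u := by
    rintro u rfl
    exact hP1 _ (by simp)
  have hPxy : ∀ x ∈ K, ∀ y, P ⁅x, y⁆ := by
    intro x hx
    refine h.gen K (hinvK τ) (hinvK ρ) (fun x => ∀ y, P ⁅x, y⁆) ?_ ?_ ?_ ?_ x hx
    · intro x hx x' hx' hp hp' y
      refine hPm _ (hcM x' hx' y) _ (hcM x hx y) (hp' y) (hp y) _ ?_
      have : ⁅x * x', y⁆ = x * ⁅x', y⁆ * x⁻¹ * ⁅x, y⁆ := by
        simp only [commutatorElement_def]; group
      rw [this, map_mul, map_mul, map_mul, ← hcen _ (hcM x' hx' y), map_inv]; group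
    all_goals
      intro x hx hxf y
      refine h.gen ⊤ (fun _ _ => Subgroup.mem_top _) (fun _ _ => Subgroup.mem_top _)
        (fun y => P ⁅x, y⁆) ?_ ?_ ?_ ?_ y (Subgroup.mem_top _)
      · intro y _ y' _ hp hp'
        refine hPm _ (hcM x hx y) _ (hcM x hx y') hp hp' _ ?_
        have : ⁅x, y * y'⁆ = ⁅x, y⁆ * (y * ⁅x, y'⁆ * y⁻¹) := by
          simp only [commutatorElement_def]; group
        rw [this, map_mul, map_mul, map_mul, ← hcen _ (hcM x hx y'), map_inv]; group
    · intro y _ hy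
      exact hone _ (commutatorElement_eq_one_iff_mul_comm.mpr (h.comm_of_fix hxf hy))
    · intro y _ hy
      obtain ⟨s, hs, e⟩ := hst x⁻¹ y (by rw [map_inv, hxf]) hy
        (by rw [← commutatorElement_inv]; exact M.inv_mem (hcM _ (K.inv_mem hx) _))
        (by rw [← commutatorElement_inv, inv_inv]; exact M.inv_mem (hcM _ hx _))
      refine hPs _ s hs ?_ ?_
      · rw [map_commutatorElement, map_commutatorElement, is_t hxf, it_r hy, map_inv, map_inv,
          comm_inv_inv _ _ (hcc x hx y), map_commutatorElement]
      · rw [← e, ← commutatorElement_inv x⁻¹ y, map_inv, map_commutatorElement, map_commutatorElement,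
          map_inv, comm_inv_left _ _ (hcc x hx y), inv_inv]
    · intro y _ hy
      refine hP1 _ ?_
      rw [map_commutatorElement, map_commutatorElement, is_t hxf, hy, map_inv,
        comm_inv_left _ _ (hcc x hx y), map_commutatorElement]
    · intro y _ hy
      obtain ⟨s, hs, e⟩ := hst y x hy hxf (hcM _ hx _) (hcM _ (K.inv_mem hx) _)
      refine hPs _ s hs ?_ e
      rw [map_commutatorElement, map_commutatorElement, is_t hy, it_r hxf, map_inv, map_inv,
          comm_inv_inv _ _ (hcc x hx y), map_commutatorElement]
    · intro y _ hy
      exact hone _ (commutatorElement_eq_one_iff_mul_comm.mpr (h.rot.comm_of_fix hxf hy))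
    · intro y _ hy
      refine hP1 _ ?_
      rw [map_commutatorElement, map_commutatorElement, it_r hxf, hy, map_inv,
        comm_inv_left _ _ (hcc x hx y), map_commutatorElement]
    · intro y _ hy
      refine hP1 _ ?_
      rw [map_commutatorElement, map_commutatorElement, is_t hy, hxf, map_inv,
        comm_inv_right _ _ (hcc x hx y), map_commutatorElement]
    · intro y _ hy
      refine hP1 _ ?_
      rw [map_commutatorElement, map_commutatorElement, it_r hy, hxf, map_inv,
        comm_inv_right _ _ (hcc x hx y), map_commutatorElement]
    · intro y _ hy
      exact hone _ (commutatorElement_eq_one_iff_mul_comm.mpr (h.rot.rot.comm_of_fix hxf hy))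
  have hPg : ∀ u, u ∈ M → P u := by
    intro u hu
    have hu' := hu
    rw [hM, Subgroup.commutator_def] at hu'
    have key : u ∈ M ∧ P u := by
      induction hu' using Subgroup.closure_induction with
      | mem x hx =>
        obtain ⟨a, ha, b, -, rfl⟩ := hx
        exact ⟨hcM a ha b, hPxy a ha b⟩
      | one => exact ⟨M.one_mem, hone _ rfl⟩
      | mul x y hx hy ihx ihy =>
        rw [← Subgroup.commutator_def, ← hM] at hx hy
        exact ⟨M.mul_mem hx hy, hPm _ hx _ hy (ihx hx).2 (ihy hy).2 _ (map_mul _ _ _)⟩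
      | inv x hx ih =>
        rw [← Subgroup.commutator_def, ← hM] at hx
        exact ⟨M.inv_mem hx, hPinv _ hx (ih hx).2⟩
    exact key.2
  obtain ⟨x, hx, e⟩ := hPg g hg
  rw [hgr] at e
  exact ⟨x, hx, (hπ _ _).mp (sq_inj hQ e).symm⟩

theorem main [Finite G] (h : KFAct m σ τ ρ) (hnil : Group.IsNilpotent G) (H : Subgroup G)
    (hHr : ∀ x ∈ H, ρ x = x)
    (hstar : ∀ a b t s : G, σ a = a → τ b = b → τ t = t → ρ s = s →
      a⁻¹ * b * a = s * t * s → s ∈ H)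
    (g : G) (hg : g ∈ commutator G) (hgr : ρ g = g) : g ∈ H := by
  obtain ⟨n, hn⟩ := Subgroup.nilpotent_iff_lowerCentralSeries.mp hnil
  have key : ∀ n, ∃ x ∈ H, x⁻¹ * g ∈ (⊤ : Subgroup G).lowerCentralSeries (n + 1) := by
    intro n
    induction n with
    | zero => exact ⟨1, H.one_mem, by
        rw [zero_add, Subgroup.top_lowerCentralSeries_one]; simpa using hg⟩
    | succ n ih =>
      obtain ⟨x, hx, hxg⟩ := ih
      obtain ⟨y, hy, hyg⟩ := h.step ((⊤ : Subgroup G).lowerCentralSeries n)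
        ((⊤ : Subgroup G).lowerCentralSeries (n + 1))
        ((⊤ : Subgroup G).lowerCentralSeries (n + 2)) rfl rfl H hHr hstar _ hxg
        (by rw [map_mul, map_inv, hHr x hx, hgr])
      refine ⟨x * y, H.mul_mem hx hy, ?_⟩
      rw [mul_inv_rev, mul_assoc]; exact hyg
  obtain ⟨x, hx, hxg⟩ := key n
  have := Subgroup.lowerCentralSeries_antitone ⊤ (Nat.le_succ n) hxg
  rw [hn, Subgroup.mem_bot, inv_mul_eq_one] at this
  exact this ▸ hx

theorem star_mem (h : KFAct m σ τ ρ) {a b t s : G} (hb : τ b = b) (ht : τ t = t)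
    (hs : ρ s = s) (e : a⁻¹ * b * a = s * t * s) : s ∈ commutator G := by
  let π := Abelianization.of (G := G)
  have hτ : τ s = s⁻¹ := h.rot.swap.inv_of_fix hs
  have e1 := congrArg π e
  have e2 := congrArg π (congrArg τ e)
  simp only [map_mul, map_inv, hb, ht, hτ] at e1 e2
  have e3 : π s = 1 := by
    have hQ : ∀ x : Abelianization G, x ^ m * x ^ m = x := by
      intro x
      obtain ⟨y, rfl⟩ := QuotientGroup.mk_surjective x
      change π y ^ m * π y ^ m = π y
      rw [← map_pow, ← map_mul, h.rt]
    have f1 : π b = π t * (π s * π s) := by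
      rw [mul_comm (π a)⁻¹, inv_mul_cancel_right] at e1
      rw [e1, mul_comm (π s) (π t), mul_assoc]
    have f2 : π b = π t * ((π s)⁻¹ * (π s)⁻¹) := by
      rw [mul_comm (π (τ a))⁻¹, inv_mul_cancel_right] at e2
      rw [e2, mul_comm _ (π t), mul_assoc]
    have f3 := sq_inj hQ (mul_left_cancel (f1.symm.trans f2))
    refine sq_inj hQ ?_
    nth_rewrite 1 [f3]
    simp
  rw [← Abelianization.ker_of]
  exact e3

end KFAct

/-- **Lemma 4.7.**  Let the Klein four-group `V = {1, v₁, v₂, v₃}` (here `w 0 = v₁`,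
`w 1 = v₂`, `w 2 = v₃ = v₁v₂`) act by automorphisms on a finite nilpotent group `G`
with `C_G(V) = 1`, and set `Gᵢ = C_G(vᵢ)`; let `{i, j, k} = {1, 2, 3}`.  Then
`G' ∩ G_k = ⟨a*b | a ∈ Gᵢ, b ∈ Gⱼ⟩`, where `a*b` denotes the unique `s ∈ G_k` for
which `b^a = s·t·s` with `t ∈ Gⱼ`. -/
theorem derived_inter_centralizer_eq_star_subgroup_of_kleinFour_action
    (V : Type) [Group V] (w : Fin 3 → V)
    (hV4 : Nat.card V = 4)
    (hinv : ∀ i, w i * w i = 1) (hne1 : ∀ i, w i ≠ 1)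
    (hw01 : w 0 * w 1 = w 1 * w 0) (hw2 : w 2 = w 0 * w 1)
    (G : Type) [Group G] [Finite G] (φ : V →* MulAut G)
    (hfpf : ∀ x : G, (∀ v : V, φ v x = x) → x = 1)
    (hnil : Group.IsNilpotent G)
    (i j k : Fin 3) (hij : i ≠ j) (hjk : j ≠ k) (hik : i ≠ k) :
    commutator G ⊓ fixedSubgroup (φ (w k)) =
      Subgroup.closure {s : G | φ (w k) s = s ∧ ∃ a b t : G,
        φ (w i) a = a ∧ φ (w j) b = b ∧ φ (w j) t = t ∧ a⁻¹ * b * a = s * t * s} := by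
  have hinj : Function.Injective ![1, w 0, w 1, w 2] := by
    have a0 := hne1 0
    have a1 := hne1 1
    have a2 := hne1 2
    have i0 := hinv 0
    have b01 : w 0 ≠ w 1 := by
      intro e; rw [hw2, ← e] at a2; exact a2 i0
    have b02 : w 0 ≠ w 2 := by
      intro e; rw [hw2] at e; exact a1 (left_eq_mul.mp e)
    have b12 : w 1 ≠ w 2 := by
      intro e; rw [hw2] at e; exact a0 (right_eq_mul.mp e)
    intro x y
    fin_cases x <;> fin_cases y <;>
      simp [a0, a1, a2, b01, b02, b12, a0.symm, a1.symm, a2.symm, b01.symm, b02.symm, b12.symm]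
  have hfinV : Finite V := Nat.finite_of_card_ne_zero (by rw [hV4]; norm_num)
  have hsurj : Function.Surjective ![1, w 0, w 1, w 2] :=
    ((Nat.bijective_iff_injective_and_card _).mpr ⟨hinj, by simp [hV4]⟩).2
  have hmulw : ∀ a b c : Fin 3, a ≠ b → b ≠ c → a ≠ c → w a * w b = w c := by
    have e02 : w 0 * w 2 = w 1 := by rw [hw2, ← mul_assoc, hinv, one_mul]
    have e20 : w 2 * w 0 = w 1 := by rw [hw2, hw01, mul_assoc, hinv, mul_one]
    have e12 : w 1 * w 2 = w 0 := by rw [hw2, hw01, ← mul_assoc, hinv, one_mul]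
    have e21 : w 2 * w 1 = w 0 := by rw [hw2, mul_assoc, hinv, mul_one]
    intro a b c
    fin_cases a <;> fin_cases b <;> fin_cases c <;> simp [e02, e20, e12, e21, hw2.symm, hw01.symm]
  have hap : ∀ a b c : Fin 3, a ≠ b → b ≠ c → a ≠ c → ∀ x, φ (w a) (φ (w b) x) = φ (w c) x := by
    intro a b c h1 h2 h3 x
    rw [← hmulw a b c h1 h2 h3, map_mul]; rfl
  have hsq : ∀ a x, φ (w a) (φ (w a) x) = x := by
    intro a x
    rw [← MulAut.mul_apply, ← map_mul, hinv, map_one]; rfl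
  have hodd : Odd (Nat.card G) := by
    letI : MulAction V G := MulAction.compHom G φ
    have hp : IsPGroup 2 V := IsPGroup.of_card (n := 2) (by rw [hV4]; norm_num)
    have := hp.card_modEq_card_fixedPoints G
    have h1 : Nat.card (MulAction.fixedPoints V G) = 1 := by
      rw [Nat.card_eq_one_iff_unique]
      refine ⟨⟨fun x y => Subtype.ext ?_⟩, ⟨⟨1, fun v => map_one (φ v)⟩⟩⟩
      rw [hfpf x.1 x.2, hfpf y.1 y.2]
    rw [h1] at this
    exact Nat.odd_iff.mpr this
  obtain ⟨r, hr⟩ := hodd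
  have hK : KFAct (r + 1) (φ (w i)) (φ (w j)) (φ (w k)) := by
    refine ⟨?_, hsq i, hsq j, hsq k, hap _ _ _ hij hjk hik, hap _ _ _ hij.symm hik hjk,
      hap _ _ _ hik hjk.symm hij, hap _ _ _ hik.symm hij hjk.symm, hap _ _ _ hjk hik.symm hij.symm,
      hap _ _ _ hjk.symm hij.symm hik.symm, ?_⟩
    · intro x
      rw [← pow_add, show r + 1 + (r + 1) = Nat.card G + 1 by omega, pow_succ, pow_card_eq_one',
        one_mul]
    · intro x h1 h2
      have h3 : φ (w k) x = x := by rw [← hap _ _ _ hij hjk hik, h2, h1]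
      have hall : ∀ a, φ (w a) x = x := by
        intro a
        have : a = i ∨ a = j ∨ a = k := by omega
        rcases this with rfl | rfl | rfl <;> assumption
      refine hfpf x fun v => ?_
      obtain ⟨a, rfl⟩ := hsurj v
      fin_cases a
      · simp
      · exact hall 0
      · exact hall 1
      · exact hall 2
  have hle : Subgroup.closure {s : G | φ (w k) s = s ∧ ∃ a b t : G,
        φ (w i) a = a ∧ φ (w j) b = b ∧ φ (w j) t = t ∧ a⁻¹ * b * a = s * t * s} ≤
        commutator G ⊓ fixedSubgroup (φ (w k)) := by
    rw [Subgroup.closure_le]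
    rintro s ⟨hs, a, b, t, ha, hb, ht, e⟩
    exact ⟨hK.star_mem hb ht hs e, hs⟩
  refine le_antisymm ?_ hle
  rintro g ⟨hg, hgr⟩
  refine hK.main hnil _ (fun x hx => (hle hx).2) ?_ g hg hgr
  intro a b t s ha hb ht hs e
  exact Subgroup.subset_closure ⟨hs, a, b, t, ha, hb, ht, e⟩
end

section
/- Let V act on the finite group G as in the context with C_G(V) = 1, and let i ∈ {1, 2, 3}. Suppose that N is a normal subgroup of G such that N ⊆ G_i. Then N is contained in the center Z(G) of G. -/
/-- For an involutive automorphism `f` of a finite group of odd order, each `g` can be corrected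
by a power of `g⁻¹ f(g)` to a fixed point of `f`. -/
lemma exists_fixed_correction {G : Type} [Group G] (hodd : Odd (Nat.card G))
    (f : G ≃* G) (hf : ∀ x, f (f x) = x) (g : G) :
    ∃ k : ℕ, f (g * (g⁻¹ * f g) ^ k) = g * (g⁻¹ * f g) ^ k ∧
      f ((g⁻¹ * f g) ^ k) = ((g⁻¹ * f g) ^ k)⁻¹ := by
  obtain ⟨m, hm⟩ := hodd
  refine ⟨m + 1, ?_⟩
  set x := g⁻¹ * f g with hx
  have hxc : x ^ (2 * m + 1) = 1 := by rw [← hm]; exact pow_card_eq_one'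
  have hsq : x ^ (m + 1) * x ^ (m + 1) = x := by
    rw [← pow_add, show m + 1 + (m + 1) = (2 * m + 1) + 1 by ring, pow_succ, hxc, one_mul]
  have hfx : f x = x⁻¹ := by simp [hx, hf]
  have hfy : f (x ^ (m + 1)) = (x ^ (m + 1))⁻¹ := by rw [map_pow, hfx, inv_pow]
  refine ⟨?_, hfy⟩
  have hfg : f g = g * x := by simp [hx]
  rw [map_mul, hfy, hfg, mul_assoc]
  congr 1
  rw [mul_inv_eq_iff_eq_mul, hsq]

/-- **Lemma 4.8.**  Let the Klein four-group `V = {1, v₁, v₂, v₃}` (here `w 0 = v₁`,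
`w 1 = v₂`, `w 2 = v₃ = v₁v₂`) act by automorphisms on a finite group `G` with
`C_G(V) = 1`, and set `Gᵢ = C_G(vᵢ)`.  If `N` is a normal subgroup of `G` with
`N ⊆ Gᵢ`, then `N ≤ Z(G)`. -/
theorem normal_subgroup_of_centralizer_le_center_of_kleinFour_action
    (V : Type) [Group V] (w : Fin 3 → V)
    (hV4 : Nat.card V = 4)
    (hinv : ∀ i, w i * w i = 1) (hne1 : ∀ i, w i ≠ 1)
    (hw01 : w 0 * w 1 = w 1 * w 0) (hw2 : w 2 = w 0 * w 1)
    (G : Type) [Group G] [Finite G] (φ : V →* MulAut G)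
    (hfpf : ∀ x : G, (∀ v : V, φ v x = x) → x = 1)
    (i : Fin 3) (N : Subgroup G) (hN : N.Normal)
    (hNGi : ∀ x ∈ N, φ (w i) x = x) :
    N ≤ Subgroup.center G := by
  have hVfin : Finite V := Nat.finite_of_card_ne_zero (by omega)
  have h01 : w 0 ≠ w 1 := fun h => hne1 2 (by rw [hw2, h, hinv])
  have h20 : w 2 ≠ w 0 := fun h => hne1 1 (by rw [hw2] at h; simpa using h)
  have h21 : w 2 ≠ w 1 := fun h => hne1 0 (by rw [hw2] at h; simpa using h)
  have hwinj : ∀ i j, i ≠ j → w i ≠ w j := by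
    intro i j hij
    fin_cases i <;> fin_cases j <;> first | exact absurd rfl hij | assumption | (apply Ne.symm; assumption)
  -- `|G|` is odd
  have hodd : Odd (Nat.card G) := by
    letI : MulAction V G := MulAction.compHom G φ
    have hp : IsPGroup 2 V := IsPGroup.of_card (n := 2) (by rw [hV4]; norm_num)
    haveI : Fact (Nat.Prime 2) := ⟨Nat.prime_two⟩
    have h := hp.card_modEq_card_fixedPoints G
    have h1 : MulAction.fixedPoints V G = {1} := by
      ext x
      constructor
      · intro hx
        exact hfpf x (fun v => hx v)
      · rintro rfl v
        exact map_one (φ v)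
    rw [h1] at h
    simp only [Nat.card_eq_fintype_card, Fintype.card_unique] at h
    rw [Nat.odd_iff]
    simpa [Nat.ModEq] using h
  -- two of the involutions generate
  have hfix : ∀ j, j ≠ i → ∀ x, φ (w i) x = x → φ (w j) x = x → x = 1 := by
    intro j hj x hi hjx
    apply hfpf
    let S : Subgroup V :=
      { carrier := {v | φ v x = x}
        one_mem' := by simp
        mul_mem' := by
          intro a b ha hb
          simp only [Set.mem_setOf_eq] at ha hb ⊢
          rw [map_mul, MulAut.mul_apply, hb, ha]
        inv_mem' := by
          intro a ha
          simp only [Set.mem_setOf_eq] at ha ⊢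
          rw [map_inv]
          conv_lhs => rw [← ha]
          simp }
    have hdvd : Nat.card S ∣ 4 := hV4 ▸ S.card_subgroup_dvd_card
    have h3 : 3 ≤ Nat.card S := by
      classical
      have hsub : (({1, w i, w j} : Finset V) : Set V) ⊆ (S : Set V) := by
        intro v hv
        simp only [Finset.coe_insert, Finset.coe_singleton, Set.mem_insert_iff,
          Set.mem_singleton_iff] at hv
        rcases hv with rfl | rfl | rfl
        · exact S.one_mem
        · exact hi
        · exact hjx
      have hc := Set.ncard_le_ncard hsub (Set.toFinite _)
      rw [Set.ncard_coe_finset, Finset.card_eq_three.mpr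
        ⟨1, w i, w j, (hne1 i).symm, (hne1 j).symm, hwinj i j hj.symm, rfl⟩] at hc
      exact hc
    have h4 : Nat.card S = 4 := by
      have := Nat.le_of_dvd (by norm_num) hdvd
      interval_cases hS : Nat.card S
      · omega
      · rfl
    have htop : S = ⊤ := Subgroup.eq_top_of_card_eq S (by rw [h4, hV4])
    intro v
    have : v ∈ S := htop ▸ Subgroup.mem_top v
    exact this
  obtain ⟨j, hj⟩ : ∃ j : Fin 3, j ≠ i := exists_ne i
  have hinvol : ∀ k x, φ (w k) (φ (w k) x) = x := by
    intro k x
    rw [← MulAut.mul_apply, ← map_mul, hinv, map_one, MulAut.one_apply]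
  have hcomm : ∀ x, φ (w i) (φ (w j) x) = φ (w j) (φ (w i) x) := by
    intro x
    have : w i * w j = w j * w i := by
      have h := IsPGroup.commutative_of_card_eq_prime_sq (p := 2) (G := V) (by rw [hV4]; norm_num)
      exact h (w i) (w j)
    rw [← MulAut.mul_apply, ← map_mul, this, map_mul, MulAut.mul_apply]
  -- `w j` inverts the centralizer of `w i`
  have hinverts : ∀ g, φ (w i) g = g → φ (w j) g = g⁻¹ := by
    intro g hg
    obtain ⟨k, hk1, hk2⟩ := exists_fixed_correction hodd (φ (w j)) (hinvol j) g
    have h1 := hfix j hj _ (by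
      simp only [map_mul, map_pow, map_inv, hcomm, hg]) hk1
    have h2 : (g⁻¹ * φ (w j) g) ^ k = g⁻¹ := (inv_eq_of_mul_eq_one_right h1).symm
    rw [h2, map_inv, inv_inv] at hk2
    exact inv_eq_iff_eq_inv.mp hk2
  have hab : ∀ g h, φ (w i) g = g → φ (w i) h = h → g * h = h * g := by
    intro g h hg hh
    have h1 := hinverts (g * h) (by rw [map_mul, hg, hh])
    rw [map_mul, hinverts g hg, hinverts h hh, mul_inv_rev] at h1
    have h2 := congrArg (·⁻¹) h1
    simpa using h2.symm
  intro n hn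
  rw [Subgroup.mem_center_iff]
  intro g
  obtain ⟨k, hk1, -⟩ := exists_fixed_correction hodd (φ (w i)) (hinvol i) g
  have hx : Commute (g⁻¹ * φ (w i) g) n := by
    have hc := hNGi _ (hN.conj_mem n hn g)
    rw [map_mul, map_mul, map_inv, hNGi n hn] at hc
    have h3 : φ (w i) g * n = g * n * g⁻¹ * φ (w i) g := by rw [← hc]; group
    change g⁻¹ * φ (w i) g * n = n * (g⁻¹ * φ (w i) g)
    rw [mul_assoc, h3]; group
  have h1 : Commute (g * (g⁻¹ * φ (w i) g) ^ k) n := hab _ _ hk1 (hNGi n hn)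
  have h2 : Commute ((g⁻¹ * φ (w i) g) ^ k) n := hx.pow_left k
  have h3 := h1.mul_left h2.inv_left
  rw [mul_inv_cancel_right] at h3
  exact h3
end
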